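/- Let P be a finite poc set, U an ultrafilter on P, and n ∈ ℕ. Then the d∞-ball of radius n about U is convex with respect to the ℓ¹-distance: if V, W are ultrafilters with d∞(U,V) ≤ n and d∞(U,W) ≤ n, then every ultrafilter Z with ℓ¹(V,Z) + ℓ¹(Z,W) = ℓ¹(V,W) satisfies d∞(U,Z) ≤ n. -/

import Mathlib

/-- A *poc set*: a poset with least element `⊥` and an order-reversing involution
`pstar` such that `a ≤ pstar a → a = ⊥`. -/
class PocSet (P : Type) extends PartialOrder P, OrderBot P where
  pstar : P → P
  pstar_pstar : ∀ a : P, pstar (pstar a) = a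
  pstar_antitone : ∀ {a b : P}, a ≤ b → pstar b ≤ pstar a
  eq_bot_of_le_pstar : ∀ a : P, a ≤ pstar a → a = ⊥

namespace PocSet

variable {P : Type} [PocSet P]

/-- An *ultrafilter* on a poc set: a complete `⋆`-selection (for every `a`, exactly
one of `a`, `a⋆` belongs) which is coherent (no `a, b ∈ U` satisfy `a ≤ b⋆`). -/
def IsUltra (U : Set P) : Prop :=
  (∀ a : P, a ∈ U ↔ pstar a ∉ U) ∧ ∀ a ∈ U, ∀ b ∈ U, ¬ a ≤ pstar b

/-- Two elements are *nested* if one of the four nesting relations holds. -/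
def Nested (a b : P) : Prop :=
  a ≤ b ∨ a ≤ pstar b ∨ pstar a ≤ b ∨ pstar a ≤ pstar b

/-- A set is *nested* if its elements are pairwise nested. -/
def NestedSet (N : Set P) : Prop := ∀ a ∈ N, ∀ b ∈ N, Nested a b

/-- A set is *transverse* if no two distinct elements of it are nested. -/
def Transverse (A : Set P) : Prop := ∀ a ∈ A, ∀ b ∈ A, a ≠ b → ¬ Nested a b

/-- The set of minimal elements of `V` (w.r.t. the order induced from `P`). -/
def minset (V : Set P) : Set P := {a ∈ V | ∀ b ∈ V, b ≤ a → b = a}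

/-- An element is *proper* if it is neither `0` nor `0⋆`. -/
def IsProper (a : P) : Prop := a ≠ ⊥ ∧ a ≠ pstar (⊥ : P)

/-- `d∞(U,W)`: the maximum cardinality of a nested subset of `U \ W`. -/
noncomputable def dinfty (U W : Set P) : ℕ :=
  sSup {n : ℕ | ∃ N : Set P, N ⊆ U \ W ∧ NestedSet N ∧ N.ncard = n}

/-- The `ℓ¹`-distance between ultrafilters on a finite poc set: `|U \ W|`. -/
noncomputable def ellone (U W : Set P) : ℕ := (U \ W).ncard

end PocSet

open PocSet

namespace PocSet

variable {P : Type} [PocSet P]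

theorem IsUltra.mem_of_le {V : Set P} (hV : IsUltra V) {a b : P} (ha : a ∈ V) (hab : a ≤ b) :
    b ∈ V := by
  by_contra hb
  have hb' : pstar b ∈ V := by_contra fun h => hb ((hV.1 b).2 h)
  exact hV.2 a ha _ hb' (by rwa [pstar_pstar])

/-- Nested elements separating two ultrafilters on the same side are comparable. -/
theorem Nested.le_or_le {U Z : Set P} (hU : IsUltra U) (hZ : IsUltra Z) {a b : P}
    (ha : a ∈ U \ Z) (hb : b ∈ U \ Z) (hab : Nested a b) : a ≤ b ∨ b ≤ a := by
  rcases hab with h | h | h | h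
  · exact Or.inl h
  · exact absurd h (hU.2 a ha.1 b hb.1)
  · have ha' : pstar a ∈ Z := by_contra fun h' => ha.2 ((hZ.1 a).2 h')
    exact absurd (hZ.mem_of_le ha' h) hb.2
  · right
    simpa only [pstar_pstar] using pstar_antitone h

theorem ncard_le_dinfty [Finite P] {U W N : Set P} (hN : N ⊆ U \ W) (hN' : NestedSet N) :
    N.ncard ≤ dinfty U W := by
  refine le_csSup ⟨(U \ W).ncard, ?_⟩ ⟨N, hN, hN', rfl⟩
  rintro _ ⟨M, hM, -, rfl⟩
  exact Set.ncard_le_ncard hM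

theorem inter_subset_of_ellone_add_eq {α : Type} [Finite α] {V W Z : Set α}
    (h : ellone V Z + ellone Z W = ellone V W) : V ∩ W ⊆ Z := by
  have hsub : V \ W ⊆ (V \ Z) ∪ (Z \ W) := by
    rintro a ⟨ha, hb⟩
    by_cases hz : a ∈ Z
    · exact Or.inr ⟨hz, hb⟩
    · exact Or.inl ⟨ha, hz⟩
  have heq : V \ W = (V \ Z) ∪ (Z \ W) :=
    Set.eq_of_subset_of_ncard_le hsub ((Set.ncard_union_le _ _).trans h.le)
  rintro a ⟨hv, hw⟩
  by_contra hz
  have ha : a ∈ V \ W := heq ▸ Or.inl ⟨hv, hz⟩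
  exact ha.2 hw

end PocSet

/-- Property (†): `d∞`-balls of integer radius about an ultrafilter `U` are convex
with respect to the `ℓ¹`-distance. -/
theorem dinfty_balls_ellone_convex {P : Type} [PocSet P] [Finite P]
    {U : Set P} (hU : IsUltra U) (n : ℕ)
    {V W : Set P} (hV : IsUltra V) (hW : IsUltra W)
    (hVn : dinfty U V ≤ n) (hWn : dinfty U W ≤ n) :
    ∀ Z : Set P, IsUltra Z →
      ellone V Z + ellone Z W = ellone V W → dinfty U Z ≤ n := by
  intro Z hZ h
  refine csSup_le' ?_
  rintro _ ⟨N, hN, hnest, rfl⟩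
  rcases N.eq_empty_or_nonempty with rfl | hne
  · simp
  obtain ⟨m, hm⟩ := N.toFinite.exists_maximal hne
  have hle : ∀ a ∈ N, a ≤ m := fun a ha =>
    (Nested.le_or_le hU hZ (hN ha) (hN hm.1) (hnest a ha m hm.1)).elim id (hm.2 ha)
  by_cases hmV : m ∈ V
  · have hmW : m ∉ W := fun hmW => (hN hm.1).2 (inter_subset_of_ellone_add_eq h ⟨hmV, hmW⟩)
    exact (ncard_le_dinfty
      (fun a ha => ⟨(hN ha).1, fun h' => hmW (hW.mem_of_le h' (hle a ha))⟩) hnest).trans hWn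
  · exact (ncard_le_dinfty
      (fun a ha => ⟨(hN ha).1, fun h' => hmV (hV.mem_of_le h' (hle a ha))⟩) hnest).trans hVn
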